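/- Let ν be a Borel probability measure on Sym_n with finite first moment and barycenter [ν] = ∫ ξ dν(ξ). Suppose ν = t ν₀ + (1−t) ν₁ for some t ∈ [0,1] and probability measures ν₀, ν₁ on Sym_n with finite first moments, such that the support of ν₀ is contained in { ξ ∈ Sym_n : det ξ = 0 } and det([ν₁]) = 0. Then ∫ j*(ξ) dν(ξ) ≥ (\bar j)*([ν]). -/

import Mathlib

open MeasureTheory

noncomputable section

/-- The trace (Frobenius) inner product `z·ξ = trace(zξ)` on symmetric matrices. -/
def mdot {n : ℕ} (z ξ : Matrix (Fin n) (Fin n) ℝ) : ℝ := Matrix.trace (z * ξ)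

/-- Fenchel conjugate of a function on the space of real symmetric `n×n` matrices:
`f*(ξ) = sup { z·ξ - f z : z ∈ Sym_n }`. -/
def fstar {n : ℕ} (f : Matrix (Fin n) (Fin n) ℝ → ℝ) (ξ : Matrix (Fin n) (Fin n) ℝ) : ℝ :=
  sSup { r : ℝ | ∃ z : Matrix (Fin n) (Fin n) ℝ, z.IsSymm ∧ r = mdot z ξ - f z }

/-- `j_k(z) = sup { z·ξ - j*(ξ) : ξ ∈ G_k }`, where `G_k` is the set of symmetric
matrices of rank at most `k`. -/
def jk {n : ℕ} (j : Matrix (Fin n) (Fin n) ℝ → ℝ) (k : ℕ) (z : Matrix (Fin n) (Fin n) ℝ) : ℝ :=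
  sSup { r : ℝ | ∃ ξ : Matrix (Fin n) (Fin n) ℝ, ξ.IsSymm ∧ ξ.rank ≤ k ∧
    r = mdot z ξ - fstar j ξ }

instance matMeasurableSpace (n : ℕ) : MeasurableSpace (Matrix (Fin n) (Fin n) ℝ) :=
  (inferInstance : MeasurableSpace (Fin n → Fin n → ℝ))

/-- A measure on the space of `n×n` real matrices has finite first moment if each entry
is integrable. -/
def FiniteFirstMoment {n : ℕ} (ν : Measure (Matrix (Fin n) (Fin n) ℝ)) : Prop :=
  ∀ i j : Fin n, Integrable (fun s : Matrix (Fin n) (Fin n) ℝ => s i j) ν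

/-- The barycenter `[ν] = ∫ s dν(s)` of a measure on matrices, computed entrywise. -/
def bary {n : ℕ} (ν : Measure (Matrix (Fin n) (Fin n) ℝ)) : Matrix (Fin n) (Fin n) ℝ :=
  Matrix.of fun i j => ∫ s, s i j ∂ν

/-- The set of values `∫ j* dν` over Borel probability measures `ν` on `Sym_n` supported
in `G_k` (symmetric matrices of rank ≤ k), with finite first moment and barycenter `ξ`. -/
def gkSet {n : ℕ} (j : Matrix (Fin n) (Fin n) ℝ → ℝ) (k : ℕ)
    (ξ : Matrix (Fin n) (Fin n) ℝ) : Set ℝ :=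
  { r : ℝ | ∃ ν : Measure (Matrix (Fin n) (Fin n) ℝ), IsProbabilityMeasure ν ∧
      ν {s : Matrix (Fin n) (Fin n) ℝ | ¬ (s.IsSymm ∧ s.rank ≤ k)} = 0 ∧
      FiniteFirstMoment ν ∧ bary ν = ξ ∧
      Integrable (fstar j) ν ∧ r = ∫ s, fstar j s ∂ν }

/-- `g_k(ξ) = inf { ∫ j* dν : ν probability on Sym_n, spt ν ⊆ G_k, [ν] = ξ }`. -/
def gk {n : ℕ} (j : Matrix (Fin n) (Fin n) ℝ → ℝ) (k : ℕ)
    (ξ : Matrix (Fin n) (Fin n) ℝ) : ℝ :=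
  sInf (gkSet j k ξ)

theorem QuadraticMap.PosDef.exists_dual_sub_le {V : Type*} [AddCommGroup V] [Module ℝ V]
    [FiniteDimensional ℝ V] (Q : QuadraticForm ℝ V) (hQ : Q.PosDef) (φ : Module.Dual ℝ V) :
    ∃ c : ℝ, ∀ v : V, φ v - Q v ≤ c := by
  have hinj : Function.Injective Q.polarBilin := by
    rw [← LinearMap.ker_eq_bot, LinearMap.ker_eq_bot']
    intro v hv
    by_contra hne
    have hpolar : Q.polarBilin v v = 0 := by rw [hv]; rfl
    have hself : QuadraticMap.polar Q v v = 2 • Q v := QuadraticMap.polar_self Q v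
    have hpos := hQ v hne
    simp only [QuadraticMap.polarBilin_apply_apply, hself, nsmul_eq_mul, Nat.cast_ofNat] at hpolar
    linarith
  obtain ⟨v₀, rfl⟩ := (LinearMap.injective_iff_surjective_of_finrank_eq_finrank
    (Subspace.dual_finrank_eq (K := ℝ) (V := V)).symm).mp hinj φ
  refine ⟨Q v₀, fun v => ?_⟩
  have hnonneg : 0 ≤ Q (v₀ + -v) := hQ.nonneg _
  have hadd := QuadraticMap.map_add Q v₀ (-v)
  rw [QuadraticMap.map_neg, QuadraticMap.polar_neg_right] at hadd
  rw [QuadraticMap.polarBilin_apply_apply]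
  linarith

theorem Matrix.rank_le_pred_of_det_eq_zero {n : ℕ} {A : Matrix (Fin n) (Fin n) ℝ}
    (hA : A.det = 0) : A.rank ≤ n - 1 := by
  obtain ⟨v, hv, hAv⟩ := Matrix.exists_mulVec_eq_zero_iff.mpr hA
  have hdim := LinearMap.finrank_range_add_finrank_ker A.mulVecLin
  have hker : 0 < Module.finrank ℝ (LinearMap.ker A.mulVecLin) := by
    rw [Module.finrank_pos_iff_exists_ne_zero]
    exact ⟨⟨v, hAv⟩, fun h => hv (congrArg Subtype.val h)⟩
  rw [Module.finrank_fin_fun] at hdim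
  rw [Matrix.rank]
  omega

/-- The space of real symmetric `n×n` matrices. -/
def symmSubmodule (n : ℕ) : Submodule ℝ (Matrix (Fin n) (Fin n) ℝ) where
  carrier := {z | z.IsSymm}
  add_mem' := fun ha hb => ha.add hb
  zero_mem' := Matrix.isSymm_zero
  smul_mem' := fun c _ ha => ha.smul c

section Conjugate

variable {n : ℕ} {j : Matrix (Fin n) (Fin n) ℝ → ℝ}

theorem bddAbove_fstar
    (hquad : ∃ Q : QuadraticForm ℝ (Matrix (Fin n) (Fin n) ℝ),
      ∀ z : Matrix (Fin n) (Fin n) ℝ, z.IsSymm → j z = Q z)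
    (hpos : ∀ z : Matrix (Fin n) (Fin n) ℝ, z.IsSymm → z ≠ 0 → 0 < j z)
    (ξ : Matrix (Fin n) (Fin n) ℝ) :
    BddAbove { r : ℝ | ∃ z : Matrix (Fin n) (Fin n) ℝ, z.IsSymm ∧ r = mdot z ξ - j z } := by
  obtain ⟨Q, hQ⟩ := hquad
  obtain ⟨c, hc⟩ := QuadraticMap.PosDef.exists_dual_sub_le (Q.comp (symmSubmodule n).subtype)
    (fun z hz => by
      have hz' : (z : Matrix (Fin n) (Fin n) ℝ) ≠ 0 := fun h => hz (Subtype.ext h)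
      simpa [← hQ _ z.2] using hpos _ z.2 hz')
    ((Matrix.traceLinearMap (Fin n) ℝ ℝ ∘ₗ LinearMap.mulRight ℝ ξ) ∘ₗ (symmSubmodule n).subtype)
  refine ⟨c, ?_⟩
  rintro r ⟨z, hz, rfl⟩
  rw [hQ z hz]
  exact hc ⟨z, hz⟩

theorem mdot_sub_le_fstar
    (hbdd : ∀ ξ, BddAbove { r : ℝ | ∃ z : Matrix (Fin n) (Fin n) ℝ,
      z.IsSymm ∧ r = mdot z ξ - j z })
    {z : Matrix (Fin n) (Fin n) ℝ} (hz : z.IsSymm) (ξ : Matrix (Fin n) (Fin n) ℝ) :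
    mdot z ξ - j z ≤ fstar j ξ :=
  le_csSup (hbdd ξ) ⟨z, hz, rfl⟩

theorem mdot_sub_jk_le_fstar
    (hbdd : ∀ ξ, BddAbove { r : ℝ | ∃ z : Matrix (Fin n) (Fin n) ℝ,
      z.IsSymm ∧ r = mdot z ξ - j z })
    {k : ℕ} {z ξ : Matrix (Fin n) (Fin n) ℝ} (hz : z.IsSymm) (hξ : ξ.IsSymm)
    (hrank : ξ.rank ≤ k) :
    mdot z ξ - jk j k z ≤ fstar j ξ := by
  have hjk : mdot z ξ - fstar j ξ ≤ jk j k z := by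
    refine le_csSup ⟨j z, ?_⟩ ⟨ξ, hξ, hrank, rfl⟩
    rintro r ⟨η, -, -, rfl⟩
    linarith [mdot_sub_le_fstar hbdd hz η]
  linarith

end Conjugate

section Barycenter

variable {n : ℕ} {ν : Measure (Matrix (Fin n) (Fin n) ℝ)}

theorem mdot_eq_sum (z ξ : Matrix (Fin n) (Fin n) ℝ) :
    mdot z ξ = ∑ i, ∑ k, z i k * ξ k i := by
  simp [mdot, Matrix.trace, Matrix.mul_apply]

theorem FiniteFirstMoment.integrable_mdot (hν : FiniteFirstMoment ν)
    (z : Matrix (Fin n) (Fin n) ℝ) : Integrable (mdot z) ν := by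
  simp only [funext (mdot_eq_sum z)]
  exact integrable_finsetSum _ fun i _ => integrable_finsetSum _ fun k _ =>
    (hν k i).const_mul _

theorem FiniteFirstMoment.integral_mdot (hν : FiniteFirstMoment ν)
    (z : Matrix (Fin n) (Fin n) ℝ) : ∫ s, mdot z s ∂ν = mdot z (bary ν) := by
  simp only [mdot_eq_sum]
  refine (integral_finsetSum _ fun i _ =>
    integrable_finsetSum _ fun k _ => (hν k i).const_mul (z i k)).trans ?_
  refine Finset.sum_congr rfl fun i _ => ?_
  refine (integral_finsetSum _ fun k _ => (hν k i).const_mul (z i k)).trans ?_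
  exact Finset.sum_congr rfl fun k _ => integral_const_mul _ _

theorem bary_isSymm (hsym : ∀ᵐ s ∂ν, s.IsSymm) : (bary ν).IsSymm :=
  Matrix.IsSymm.ext fun _ _ => integral_congr_ae (hsym.mono fun _ hs => hs.apply _ _)

theorem FiniteFirstMoment.ofReal_mdot_bary_sub_le_lintegral [IsProbabilityMeasure ν]
    (hν : FiniteFirstMoment ν) (z : Matrix (Fin n) (Fin n) ℝ) (c : ℝ)
    {f : Matrix (Fin n) (Fin n) ℝ → ℝ} (hf : ∀ᵐ s ∂ν, mdot z s - c ≤ f s) :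
    ENNReal.ofReal (mdot z (bary ν) - c) ≤ ∫⁻ s, ENNReal.ofReal (f s) ∂ν := by
  have hint : Integrable (fun s => mdot z s - c) ν :=
    (hν.integrable_mdot z).sub (integrable_const c)
  have heq : ∫ s, (mdot z s - c) ∂ν = mdot z (bary ν) - c := by
    rw [integral_sub (hν.integrable_mdot z) (integrable_const c), hν.integral_mdot]
    simp
  calc ENNReal.ofReal (mdot z (bary ν) - c)
      ≤ ENNReal.ofReal (∫⁻ s, ENNReal.ofReal (mdot z s - c) ∂ν).toReal := by
        rw [← heq, integral_eq_lintegral_pos_part_sub_lintegral_neg_part hint]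
        exact ENNReal.ofReal_le_ofReal (sub_le_self _ ENNReal.toReal_nonneg)
    _ ≤ ∫⁻ s, ENNReal.ofReal (mdot z s - c) ∂ν := ENNReal.ofReal_toReal_le
    _ ≤ ∫⁻ s, ENNReal.ofReal (f s) ∂ν :=
        lintegral_mono_ae (hf.mono fun _ hs => ENNReal.ofReal_le_ofReal hs)

/-- Jensen's inequality for the Fenchel conjugate. -/
theorem FiniteFirstMoment.ofReal_fstar_bary_le_lintegral [IsProbabilityMeasure ν]
    (hν : FiniteFirstMoment ν) {j : Matrix (Fin n) (Fin n) ℝ → ℝ}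
    (hbdd : ∀ ξ, BddAbove { r : ℝ | ∃ z : Matrix (Fin n) (Fin n) ℝ,
      z.IsSymm ∧ r = mdot z ξ - j z }) :
    ENNReal.ofReal (fstar j (bary ν)) ≤ ∫⁻ s, ENNReal.ofReal (fstar j s) ∂ν := by
  rcases eq_or_ne (∫⁻ s, ENNReal.ofReal (fstar j s) ∂ν) ⊤ with htop | htop
  · rw [htop]; exact le_top
  refine (ENNReal.ofReal_le_iff_le_toReal htop).mpr
    (csSup_le ⟨_, 0, Matrix.isSymm_zero, rfl⟩ ?_)
  rintro r ⟨w, hw, rfl⟩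
  exact (ENNReal.ofReal_le_iff_le_toReal htop).mp
    (hν.ofReal_mdot_bary_sub_le_lintegral w _ (.of_forall (mdot_sub_le_fstar hbdd hw)))

end Barycenter

/-- if a probability measure `ν` on `Sym_n` with finite first moment
decomposes as `ν = t ν₀ + (1-t) ν₁` with `ν₀` supported in `{det = 0}` and
`det([ν₁]) = 0`, then `∫ j* dν ≥ (\bar j)*([ν])`, where `\bar j := j_{n-1}`
(the integral of the nonnegative function `j*` is taken in `[0,∞]`). -/
theorem integral_jstar_ge_of_decomposition (n : ℕ) (hn : 1 ≤ n)
    (j : Matrix (Fin n) (Fin n) ℝ → ℝ)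
    (hquad : ∃ Q : QuadraticForm ℝ (Matrix (Fin n) (Fin n) ℝ),
      ∀ z : Matrix (Fin n) (Fin n) ℝ, z.IsSymm → j z = Q z)
    (hpos : ∀ z : Matrix (Fin n) (Fin n) ℝ, z.IsSymm → z ≠ 0 → 0 < j z)
    (ν ν₀ ν₁ : Measure (Matrix (Fin n) (Fin n) ℝ))
    (hprob : IsProbabilityMeasure ν) (hprob0 : IsProbabilityMeasure ν₀)
    (hprob1 : IsProbabilityMeasure ν₁)
    (hsym : ν {s : Matrix (Fin n) (Fin n) ℝ | ¬ s.IsSymm} = 0)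
    (hsym0 : ν₀ {s : Matrix (Fin n) (Fin n) ℝ | ¬ s.IsSymm} = 0)
    (hsym1 : ν₁ {s : Matrix (Fin n) (Fin n) ℝ | ¬ s.IsSymm} = 0)
    (hmom : FiniteFirstMoment ν) (hmom0 : FiniteFirstMoment ν₀)
    (hmom1 : FiniteFirstMoment ν₁)
    (t : ℝ) (ht0 : 0 ≤ t) (ht1 : t ≤ 1)
    (hmix : ν = ENNReal.ofReal t • ν₀ + ENNReal.ofReal (1 - t) • ν₁)
    (hdet0 : ν₀ {ξ : Matrix (Fin n) (Fin n) ℝ | ξ.det ≠ 0} = 0)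
    (hdet1 : (bary ν₁).det = 0) :
    ENNReal.ofReal (fstar (jk j (n - 1)) (bary ν))
      ≤ ∫⁻ s, ENNReal.ofReal (fstar j s) ∂ν := by
  have hbdd := bddAbove_fstar hquad hpos
  have hsymm : ∀ᵐ s ∂ν₀, s.IsSymm := ae_iff.mpr hsym0
  have hsing : ∀ᵐ s ∂ν₀, s.det = 0 := ae_iff.mpr hdet0
  rcases eq_or_ne (∫⁻ s, ENNReal.ofReal (fstar j s) ∂ν) ⊤ with htop | htop
  · rw [htop]; exact le_top
  refine (ENNReal.ofReal_le_iff_le_toReal htop).mpr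
    (csSup_le ⟨_, 0, Matrix.isSymm_zero, rfl⟩ ?_)
  rintro r ⟨z, hz, rfl⟩
  refine (ENNReal.ofReal_le_iff_le_toReal htop).mp ?_
  have h₀ : ENNReal.ofReal (mdot z (bary ν₀) - jk j (n - 1) z)
      ≤ ∫⁻ s, ENNReal.ofReal (fstar j s) ∂ν₀ := by
    refine hmom0.ofReal_mdot_bary_sub_le_lintegral z _ ?_
    filter_upwards [hsymm, hsing] with s hs hs'
    exact mdot_sub_jk_le_fstar hbdd hz hs (Matrix.rank_le_pred_of_det_eq_zero hs')
  have h₁ : ENNReal.ofReal (mdot z (bary ν₁) - jk j (n - 1) z)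
      ≤ ∫⁻ s, ENNReal.ofReal (fstar j s) ∂ν₁ :=
    (ENNReal.ofReal_le_ofReal (mdot_sub_jk_le_fstar hbdd hz (bary_isSymm (ae_iff.mpr hsym1))
      (Matrix.rank_le_pred_of_det_eq_zero hdet1))).trans
      (hmom1.ofReal_fstar_bary_le_lintegral hbdd)
  have hbary : mdot z (bary ν) = t * mdot z (bary ν₀) + (1 - t) * mdot z (bary ν₁) := by
    rw [← hmom.integral_mdot, ← hmom0.integral_mdot, ← hmom1.integral_mdot, hmix,
      integral_add_measure ((hmom0.integrable_mdot z).smul_measure ENNReal.ofReal_ne_top)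
        ((hmom1.integrable_mdot z).smul_measure ENNReal.ofReal_ne_top),
      integral_smul_measure, integral_smul_measure, ENNReal.toReal_ofReal ht0,
      ENNReal.toReal_ofReal (sub_nonneg.mpr ht1), smul_eq_mul, smul_eq_mul]
  have hsplit : mdot z (bary ν) - jk j (n - 1) z
      = t * (mdot z (bary ν₀) - jk j (n - 1) z)
        + (1 - t) * (mdot z (bary ν₁) - jk j (n - 1) z) := by
    rw [hbary]; ring
  rw [hsplit, hmix, lintegral_add_measure, lintegral_smul_measure, lintegral_smul_measure]
  refine ENNReal.ofReal_add_le.trans ?_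
  rw [ENNReal.ofReal_mul ht0, ENNReal.ofReal_mul (sub_nonneg.mpr ht1)]
  exact add_le_add (mul_le_mul_right h₀ _) (mul_le_mul_right h₁ _)
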